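/- Every line graph of a simple graph contains an immersion of the complete graph on χ(G) vertices (the Abu-Khzam–Langston conjecture holds for line graphs of simple graphs). -/

import Mathlib

open SimpleGraph

/-- `G` contains an immersion of the complete graph `K t`. -/
def CliqueImmersion {V : Type*} (G : SimpleGraph V) (t : ℕ) : Prop :=
  ∃ φ : Fin t ↪ V, ∃ P : (i j : Fin t) → G.Walk (φ i) (φ j),
    (∀ i j : Fin t, i < j → (P i j).IsPath) ∧
    (∀ i j i' j' : Fin t, i < j → i' < j' → (i, j) ≠ (i', j') →
      List.Disjoint (P i j).edges (P i' j').edges)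

namespace LGI

open Classical in
/-- Number of ordered crossing pairs of a vertex set. -/
noncomputable def cut {V : Type*} [Fintype V] (G : SimpleGraph V) (X : Finset V) : ℕ :=
  ∑ a : V, ∑ b : V, if G.Adj a b ∧ a ∈ X ∧ b ∉ X then 1 else 0

/-- Integral unit-capacity flow from `x` to `y` of value `n`. -/
structure IsFlow {V : Type*} [Fintype V] (G : SimpleGraph V) (x y : V) (n : ℕ)
    (f : V → V → ℤ) : Prop where
  anti : ∀ u v, f u v = - f v u
  le_one : ∀ u v, f u v ≤ 1
  adj : ∀ u v, f u v ≠ 0 → G.Adj u v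
  net : ∀ u, u ≠ x → u ≠ y → ∑ v, f u v = 0
  val : ∑ v, f x v = n

open Classical in
/-- The signed indicator of a walk. -/
noncomputable def ind {V : Type*} {G : SimpleGraph V} {x y : V} (p : G.Walk x y) (u v : V) : ℤ :=
  ((p.darts.map (fun d => d.toProd)).count (u, v) : ℤ)
    - ((p.darts.map (fun d => d.toProd)).count (v, u) : ℤ)

theorem ind_anti {V : Type*} {G : SimpleGraph V} {x y : V} (p : G.Walk x y) (u v : V) :
    ind p u v = - ind p v u := by
  unfold ind; ring

open Classical in
theorem ind_cons {V : Type*} {G : SimpleGraph V} {x y z : V} (h : G.Adj x y) (p : G.Walk y z)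
    (u v : V) : ind (Walk.cons h p) u v = ind p u v + ((if x = u ∧ y = v then 1 else 0)
      - (if x = v ∧ y = u then 1 else 0)) := by
  unfold ind
  simp only [Walk.darts_cons, List.map_cons, List.count_cons, beq_iff_eq, Prod.mk.injEq]
  push_cast
  ring

open Classical in
theorem ind_net {V : Type*} [Fintype V] {G : SimpleGraph V} {x y : V} (p : G.Walk x y) (u : V) :
    ∑ v, ind p u v = (if u = x then 1 else 0) - (if u = y then 1 else 0) := by
  induction p with
  | nil => simp [ind]
  | @cons a b c h p ih =>
    simp only [ind_cons, Finset.sum_add_distrib, ih, Finset.sum_sub_distrib]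
    have h1 : ∑ v : V, (if a = u ∧ b = v then (1:ℤ) else 0) = if u = a then 1 else 0 := by
      by_cases hu : a = u <;> simp [hu, eq_comm (a := u)]
    have h2 : ∑ v : V, (if a = v ∧ b = u then (1:ℤ) else 0) = if u = b then 1 else 0 := by
      by_cases hu : b = u <;> simp [hu, eq_comm (a := u)]
    rw [h1, h2]
    ring

open Classical in
theorem count_le_one {V : Type*} {G : SimpleGraph V} {x y : V} (p : G.Walk x y) (hp : p.IsPath)
    (u v : V) : (p.darts.map (fun d => d.toProd)).count (u, v) ≤ 1 := by
  apply List.nodup_iff_count_le_one.1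
  have h := hp.isTrail.edges_nodup
  unfold Walk.edges at h
  have h2 := List.Nodup.of_map _ h
  refine List.Nodup.map ?_ h2
  intro a b hab
  exact SimpleGraph.Dart.ext _ _ hab

open Classical in
theorem count_pos {V : Type*} {G : SimpleGraph V} {x y : V} (p : G.Walk x y)
    (u v : V) (h : (p.darts.map (fun d => d.toProd)).count (u, v) ≠ 0) :
    ∃ d ∈ p.darts, d.toProd = (u, v) := by
  have := List.count_pos_iff.1 (Nat.pos_of_ne_zero h)
  simpa using this

/-- Either a path all of whose darts satisfy `R`, or a closed set. -/
theorem path_or_cut {V : Type*} [Fintype V] (G : SimpleGraph V) (x y : V) (R : V → V → Prop) :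
    (∃ p : G.Walk x y, p.IsPath ∧ ∀ d ∈ p.darts, R d.fst d.snd) ∨
    (∃ X : Finset V, x ∈ X ∧ y ∉ X ∧ ∀ u ∈ X, ∀ v, v ∉ X → G.Adj u v → ¬ R u v) := by
  classical
  by_cases h : ∃ p : G.Walk x y, ∀ d ∈ p.darts, R d.fst d.snd
  · left
    obtain ⟨p, hp⟩ := h
    exact ⟨p.bypass, p.bypass_isPath, fun d hd => hp d (p.darts_bypass_subset_darts hd)⟩
  · right
    refine ⟨Finset.univ.filter (fun z => ∃ p : G.Walk x z, ∀ d ∈ p.darts, R d.fst d.snd),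
      ?_, ?_, ?_⟩
    · simp only [Finset.mem_filter, Finset.mem_univ, true_and]
      exact ⟨Walk.nil, by simp⟩
    · simpa using h
    · intro u hu v hv huv hR
      simp only [Finset.mem_filter, Finset.mem_univ, true_and] at hu hv
      obtain ⟨p, hp⟩ := hu
      apply hv
      refine ⟨p.concat huv, ?_⟩
      intro d hd
      rw [Walk.darts_concat] at hd
      simp only [List.concat_eq_append, List.mem_append, List.mem_singleton] at hd
      rcases hd with hd | rfl
      · exact hp d hd
      · exact hR

open Classical in
theorem flow_cut {V : Type*} [Fintype V] {G : SimpleGraph V} {x y : V} {n : ℕ}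
    {f : V → V → ℤ} (hf : IsFlow G x y n f) (X : Finset V) (hx : x ∈ X) (hy : y ∉ X) :
    (n : ℤ) = ∑ u : V, ∑ v : V, if u ∈ X ∧ v ∉ X then f u v else 0 := by
  have h1 : ∑ u ∈ X, ∑ v, f u v = n := by
    rw [← hf.val]
    apply Finset.sum_eq_single_of_mem x hx
    intro b hb hbx
    exact hf.net b hbx (fun h => hy (h ▸ hb))
  have h2 : ∑ u ∈ X, ∑ v ∈ X, f u v = 0 := by
    have : ∑ u ∈ X, ∑ v ∈ X, f u v = - ∑ u ∈ X, ∑ v ∈ X, f u v := by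
      conv_lhs => rw [Finset.sum_comm]
      rw [← Finset.sum_neg_distrib]
      refine Finset.sum_congr rfl fun u _ => ?_
      rw [← Finset.sum_neg_distrib]
      exact Finset.sum_congr rfl fun v _ => hf.anti v u
    linarith
  have h3 : ∑ u ∈ X, ∑ v, f u v = ∑ u ∈ X, ∑ v ∈ X, f u v + ∑ u ∈ X, ∑ v ∈ Xᶜ, f u v := by
    rw [← Finset.sum_add_distrib]
    exact Finset.sum_congr rfl fun u _ => (Finset.sum_add_sum_compl X _).symm
  have h4 : ∑ u : V, ∑ v : V, (if u ∈ X ∧ v ∉ X then f u v else 0)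
      = ∑ u ∈ X, ∑ v ∈ Xᶜ, f u v := by
    rw [← Finset.sum_subset (Finset.subset_univ X)]
    · refine Finset.sum_congr rfl fun u hu => ?_
      rw [← Finset.sum_subset (Finset.subset_univ Xᶜ)]
      · refine Finset.sum_congr rfl fun v hv => ?_
        rw [if_pos ⟨hu, Finset.mem_compl.1 hv⟩]
      · intro v _ hv
        rw [if_neg]
        rintro ⟨_, h⟩
        exact hv (Finset.mem_compl.2 h)
    · intro u _ hu
      apply Finset.sum_eq_zero
      intro v _
      rw [if_neg]
      rintro ⟨h, _⟩
      exact hu h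
  rw [h4]; linarith

theorem exists_flow {V : Type*} [Fintype V] (G : SimpleGraph V) {x y : V} (hxy : x ≠ y) (k : ℕ)
    (hk : ∀ X : Finset V, x ∈ X → y ∉ X → k ≤ cut G X) (n : ℕ) (hn : n ≤ k) :
    ∃ f, IsFlow G x y n f := by
  classical
  induction n with
  | zero => exact ⟨fun _ _ => 0, by simp, by simp, by simp, by simp, by simp⟩
  | succ n ih =>
    obtain ⟨f, hf⟩ := ih (by omega)
    rcases path_or_cut G x y (fun u v => f u v ≤ 0) with ⟨p, hp, hR⟩ | ⟨X, hx, hy, hX⟩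
    · refine ⟨fun u v => f u v + ind p u v, ?_, ?_, ?_, ?_, ?_⟩
      · intro u v
        have := hf.anti u v
        have := ind_anti p u v
        linarith
      · intro u v
        show f u v + ind p u v ≤ 1
        have h1 := count_le_one p hp u v
        have h0 := hf.le_one u v
        by_cases hc : (p.darts.map (fun d => d.toProd)).count (u, v) = 0
        · unfold ind; rw [hc]; push_cast; omega
        · obtain ⟨d, hd, hd2⟩ := count_pos p u v hc
          have h3 := hR d hd
          have h4 : d.fst = u := congrArg Prod.fst hd2
          have h5 : d.snd = v := congrArg Prod.snd hd2
          rw [h4, h5] at h3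
          unfold ind; omega
      · intro u v huv
        by_cases h0 : f u v = 0
        · have h1 : ind p u v ≠ 0 := by intro h; apply huv; simp [h0, h]
          by_cases hc : (p.darts.map (fun d => d.toProd)).count (u, v) = 0
          · by_cases hc' : (p.darts.map (fun d => d.toProd)).count (v, u) = 0
            · exact absurd (by unfold ind; rw [hc, hc']; simp) h1
            · obtain ⟨d, hd, hd2⟩ := count_pos p v u hc'
              have := d.adj
              rw [hd2] at this
              exact this.symm
          · obtain ⟨d, hd, hd2⟩ := count_pos p u v hc
            have := d.adj
            rw [hd2] at this
            exact this
        · exact hf.adj u v h0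
      · intro u hux huy
        rw [Finset.sum_add_distrib, ind_net, hf.net u hux huy]
        simp [hux, huy]
      · rw [Finset.sum_add_distrib, ind_net, hf.val]
        simp [hxy]
    · exfalso
      have h1 := flow_cut hf X hx hy
      have h2 := hk X hx hy
      have h3 : ((cut G X : ℕ) : ℤ) ≤ ∑ u : V, ∑ v : V, if u ∈ X ∧ v ∉ X then f u v else 0 := by
        unfold cut
        push_cast
        refine Finset.sum_le_sum fun u _ => Finset.sum_le_sum fun v _ => ?_
        by_cases huv : u ∈ X ∧ v ∉ X
        · by_cases ha : G.Adj u v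
          · have := hX u huv.1 v huv.2 ha
            simp only [ha, huv, true_and, not_false_eq_true, and_self, if_true]
            omega
          · have : f u v = 0 := by
              by_contra h; exact ha (hf.adj u v h)
            simp [ha, this]
        · rw [if_neg huv, if_neg]
          exact fun h => huv h.2
      omega

theorem flow_paths {V : Type*} [Fintype V] (G : SimpleGraph V) {x y : V} (hxy : x ≠ y) (n : ℕ)
    (f : V → V → ℤ) (hf : IsFlow G x y n f) :
    ∃ p : Fin n → G.Walk x y, (∀ i u v, s(u, v) ∈ (p i).edges → f u v ≠ 0) ∧
      ∀ i j, i ≠ j → List.Disjoint (p i).edges (p j).edges := by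
  classical
  induction n generalizing f with
  | zero => exact ⟨fun i => i.elim0, fun i => i.elim0, fun i => i.elim0⟩
  | succ n ih =>
    rcases path_or_cut G x y (fun u v => f u v = 1) with ⟨p, hp, hR⟩ | ⟨X, hx, hy, hX⟩
    · have hin : ∀ u v, (p.darts.map (fun d => d.toProd)).count (u, v) ≠ 0 → f u v = 1 := by
        intro u v hc
        obtain ⟨d, hd, hd2⟩ := count_pos p u v hc
        have h3 := hR d hd
        have h4 : d.fst = u := congrArg Prod.fst hd2
        have h5 : d.snd = v := congrArg Prod.snd hd2
        rwa [h4, h5] at h3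
      have key : ∀ u v, (ind p u v = 0 ∨ ind p u v = f u v) := by
        intro u v
        have h1 := count_le_one p hp u v
        have h2 := count_le_one p hp v u
        have h3 := hin u v
        have h4 := hin v u
        have h5 := hf.anti u v
        unfold ind
        omega
      have hpe : ∀ u v, s(u, v) ∈ p.edges → ind p u v = f u v ∧ f u v ≠ 0 := by
        intro u v he
        have h1 := count_le_one p hp u v
        have h2 := count_le_one p hp v u
        have h3 := hin u v
        have h4 := hin v u
        have h5 := hf.anti u v
        have : (p.darts.map (fun d => d.toProd)).count (u, v) ≠ 0 ∨
          (p.darts.map (fun d => d.toProd)).count (v, u) ≠ 0 := by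
          unfold Walk.edges at he
          rw [List.mem_map] at he
          obtain ⟨d, hd, hd2⟩ := he
          have hd3 : s(d.fst, d.snd) = s(u, v) := hd2
          rw [Sym2.eq_iff] at hd3
          rcases hd3 with ⟨ha, hb⟩ | ⟨ha, hb⟩
          · left
            apply Nat.pos_iff_ne_zero.1
            apply List.count_pos_iff.2
            exact List.mem_map.2 ⟨d, hd, by rw [← ha, ← hb]⟩
          · right
            apply Nat.pos_iff_ne_zero.1
            apply List.count_pos_iff.2
            exact List.mem_map.2 ⟨d, hd, by rw [← ha, ← hb]⟩
        unfold ind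
        omega
      obtain ⟨q, hq1, hq2⟩ := ih (fun u v => f u v - ind p u v) (by
        refine ⟨?_, ?_, ?_, ?_, ?_⟩
        · intro u v
          have := hf.anti u v
          have := ind_anti p u v
          linarith
        · intro u v
          have := hf.le_one u v
          show f u v - ind p u v ≤ 1
          rcases key u v with h | h <;> omega
        · intro u v h
          apply hf.adj
          intro h0
          apply h
          show f u v - ind p u v = 0
          rcases key u v with h | h <;> omega
        · intro u hux huy
          rw [Finset.sum_sub_distrib, ind_net, hf.net u hux huy]
          simp [hux, huy]
        · rw [Finset.sum_sub_distrib, ind_net, hf.val]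
          simp [hxy])
      have hpq : ∀ i, List.Disjoint p.edges (q i).edges := by
        intro i e h1 h2
        induction e using Sym2.ind with
        | _ u v =>
          apply hq1 i u v h2
          have := (hpe u v h1).1
          show f u v - ind p u v = 0
          omega
      refine ⟨Fin.cons p q, ?_, ?_⟩
      · intro i
        refine Fin.cases ?_ (fun i => ?_) i
        · intro u v h
          exact (hpe u v h).2
        · intro u v h h0
          apply hq1 i u v h
          show f u v - ind p u v = 0
          rcases key u v with h | h <;> omega
      · intro i j
        refine Fin.cases ?_ (fun i => ?_) i <;> refine Fin.cases ?_ (fun j => ?_) j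
        · intro h; exact absurd rfl h
        · intro _; exact hpq j
        · intro _; exact (hpq i).symm
        · intro h
          exact hq2 i j (fun h' => h (by rw [h']))
    · exfalso
      have h1 := flow_cut hf X hx hy
      have h3 : (∑ u : V, ∑ v : V, if u ∈ X ∧ v ∉ X then f u v else 0) ≤ 0 := by
        refine Finset.sum_nonpos fun u _ => Finset.sum_nonpos fun v _ => ?_
        by_cases huv : u ∈ X ∧ v ∉ X
        · rw [if_pos huv]
          by_cases ha : G.Adj u v
          · have := hX u huv.1 v huv.2 ha
            have := hf.le_one u v
            omega
          · have : f u v = 0 := by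
              by_contra h; exact ha (hf.adj u v h)
            omega
        · rw [if_neg huv]
      push_cast at h1
      omega

theorem menger {V : Type*} [Fintype V] (G : SimpleGraph V) {x y : V} (hxy : x ≠ y) (k : ℕ)
    (hk : ∀ X : Finset V, x ∈ X → y ∉ X → k ≤ cut G X) :
    ∃ p : Fin k → G.Walk x y, ∀ i j, i ≠ j → List.Disjoint (p i).edges (p j).edges := by
  obtain ⟨f, hf⟩ := exists_flow G hxy k hk k le_rfl
  obtain ⟨p, _, hp⟩ := flow_paths G hxy k f hf
  exact ⟨p, hp⟩


open Classical in
theorem cut_compl {V : Type*} [Fintype V] (G : SimpleGraph V) (X : Finset V) :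
    cut G Xᶜ = cut G X := by
  unfold cut
  rw [Finset.sum_comm]
  refine Finset.sum_congr rfl fun a _ => Finset.sum_congr rfl fun b _ => ?_
  refine if_congr ?_ rfl rfl
  rw [G.adj_comm]
  simp only [Finset.mem_compl, not_not]
  tauto

open Classical in
theorem cut_submod {V : Type*} [Fintype V] (G : SimpleGraph V) (X Y : Finset V) :
    cut G (X ∩ Y) + cut G (X ∪ Y) ≤ cut G X + cut G Y := by
  unfold cut
  simp only [← Finset.sum_add_distrib]
  refine Finset.sum_le_sum fun a _ => Finset.sum_le_sum fun b _ => ?_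
  by_cases h : G.Adj a b <;> by_cases h1 : a ∈ X <;> by_cases h2 : a ∈ Y <;>
    by_cases h3 : b ∈ X <;> by_cases h4 : b ∈ Y <;> simp [h, h1, h2, h3, h4]

/-- `T` splits `Y`. -/
def Splits {V : Type*} (Y T : Finset V) : Prop := (∃ a ∈ Y, a ∈ T) ∧ (∃ b ∈ Y, b ∉ T)

open Classical in
theorem gomory_hu {V : Type*} [Fintype V] (G : SimpleGraph V) (D : Finset V) (k : ℕ)
    (hD : ∀ x ∈ D, ∀ y ∈ D, x ≠ y → ∃ X : Finset V, x ∈ X ∧ y ∉ X ∧ cut G X < k)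
    (n : ℕ) (Z : Finset V) (hn : (Z ∩ D).card = n) (hn0 : 1 ≤ n) (hZk : cut G Z < k)
    (good : ∀ T, Splits (Z ∩ D) T → ∃ T', T' ⊆ Z ∧ Splits (Z ∩ D) T' ∧ cut G T' ≤ cut G T) :
    ∃ X x, X ∩ D = {x} ∧ cut G X < k := by
  induction n using Nat.strong_induction_on generalizing Z with
  | _ n ih =>
    by_cases h1 : n = 1
    · obtain ⟨x, hx⟩ := Finset.card_eq_one.1 (hn.trans h1)
      exact ⟨Z, x, hx, hZk⟩
    · obtain ⟨x, hx, y, hy, hxy⟩ := Finset.one_lt_card.1 (show 1 < (Z ∩ D).card by omega)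
      obtain ⟨T, hxT, hyT, hTk⟩ := hD x (Finset.mem_inter.1 hx).2 y (Finset.mem_inter.1 hy).2 hxy
      have hTs : Splits (Z ∩ D) T := ⟨⟨x, hx, hxT⟩, ⟨y, hy, hyT⟩⟩
      obtain ⟨W0, hW0, hW0min⟩ := Finset.exists_min_image
        (Finset.univ.filter (fun T => Splits (Z ∩ D) T)) (fun T => cut G T)
        ⟨T, by simpa using hTs⟩
      simp only [Finset.mem_filter, Finset.mem_univ, true_and] at hW0 hW0min
      obtain ⟨W, hWZ, hW, hWle⟩ := good W0 hW0
      have hWmin : ∀ T, Splits (Z ∩ D) T → cut G W ≤ cut G T :=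
        fun T hT => hWle.trans (hW0min T hT)
      obtain ⟨⟨a, ha, haW⟩, ⟨b, hb, hbW⟩⟩ := hW
      have hsub : W ∩ D ⊆ Z ∩ D := Finset.inter_subset_inter hWZ (le_refl _)
      have hlt : (W ∩ D).card < (Z ∩ D).card := by
        apply Finset.card_lt_card
        refine ⟨hsub, fun h => hbW (Finset.mem_inter.1 (h hb)).1⟩
      have hpos : 1 ≤ (W ∩ D).card :=
        Finset.card_pos.2 ⟨a, Finset.mem_inter.2 ⟨haW, (Finset.mem_inter.1 ha).2⟩⟩
      refine ih (W ∩ D).card (by omega) W rfl hpos ((hWmin T hTs).trans_lt hTk) ?_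
      have main : ∀ T, Splits (W ∩ D) T → b ∉ T →
          ∃ T', T' ⊆ W ∧ Splits (W ∩ D) T' ∧ cut G T' ≤ cut G T := by
        rintro T ⟨⟨c, hc, hcT⟩, ⟨d, hd, hdT⟩⟩ hbT
        refine ⟨W ∩ T, Finset.inter_subset_left, ⟨⟨c, hc, Finset.mem_inter.2 ⟨(Finset.mem_inter.1 hc).1, hcT⟩⟩,
          ⟨d, hd, fun h => hdT (Finset.mem_inter.1 h).2⟩⟩, ?_⟩
        have h1 := cut_submod G W T
        have h2 := hWmin (W ∪ T) ⟨⟨c, hsub hc, Finset.mem_union_right _ hcT⟩, ⟨b, hb, by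
          simp [hbW, hbT]⟩⟩
        omega
      intro T hT
      by_cases hbT : b ∈ T
      · obtain ⟨⟨c, hc, hcT⟩, ⟨d, hd, hdT⟩⟩ := hT
        obtain ⟨T', h1, h2, h3⟩ := main Tᶜ ⟨⟨d, hd, by simpa using hdT⟩, ⟨c, hc, by simpa using hcT⟩⟩
          (by simpa using hbT)
        exact ⟨T', h1, h2, h3.trans (cut_compl G T).le⟩
      · exact main T hT hbT

/-- If every vertex having a neighbour has two neighbours of degree `k`, then some two
vertices of degree `k` are not separated by a cut with fewer than `k` edges. -/
theorem exists_pair {V : Type*} [Fintype V] (G : SimpleGraph V) (k : ℕ)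
    (D : Finset V) (hdeg : ∀ x ∈ D, ∃ N : Finset V, k ≤ N.card ∧ ∀ w ∈ N, G.Adj x w)
    (hVAL : ∀ w x, G.Adj w x → ∃ u ∈ D, G.Adj w u ∧ u ≠ x) (hne : D.Nonempty) (hk : 0 < k) :
    ∃ x ∈ D, ∃ y ∈ D, x ≠ y ∧ ∀ X : Finset V, x ∈ X → y ∉ X → k ≤ cut G X := by
  classical
  by_contra hcon
  push Not at hcon
  have h0 : cut G Finset.univ = 0 := by simp [cut]
  obtain ⟨X, x, hX, hXk⟩ := gomory_hu G D k hcon (Finset.univ ∩ D).card Finset.univ rfl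
    (by rw [Finset.univ_inter]; exact hne.card_pos) (by omega)
    (fun T hT => ⟨T, Finset.subset_univ _, hT, le_rfl⟩)
  have hxX : x ∈ X ∩ D := by rw [hX]; simp
  have hxX := Finset.mem_inter.1 hxX
  obtain ⟨N, hN, hNadj⟩ := hdeg x hxX.2
  choose! u huD hua hux using fun w (h : G.Adj w x) => hVAL w x h
  have huX : ∀ w ∈ N, u w ∉ X := by
    intro w hw h
    have h1 : u w ∈ X ∩ D := Finset.mem_inter.2 ⟨h, huD w (hNadj w hw).symm⟩
    rw [hX] at h1
    exact hux w (hNadj w hw).symm (Finset.mem_singleton.1 h1)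
  have hcut : cut G X = ((Finset.univ : Finset (V × V)).filter
      (fun e => G.Adj e.1 e.2 ∧ e.1 ∈ X ∧ e.2 ∉ X)).card := by
    rw [Finset.card_filter, Fintype.sum_prod_type]
    rfl
  have : N.card ≤ cut G X := by
    rw [hcut]
    apply Finset.card_le_card_of_injOn (fun w => if w ∈ X then (w, u w) else (x, w))
    · intro w hw
      have hw : w ∈ N := hw
      by_cases h : w ∈ X
      · simp [h, hua w (hNadj w hw).symm, huX w hw]
      · simp [h, hNadj w hw, hxX.1]
    · intro w hw w' hw' heq
      have hw : w ∈ N := hw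
      have hw' : w' ∈ N := hw'
      have n1 := (hNadj w hw).ne
      have n2 := (hNadj w' hw').ne
      by_cases h : w ∈ X <;> by_cases h' : w' ∈ X <;> simp [h, h'] at heq
      · exact heq.1
      · exact absurd heq.1.symm n1
      · exact absurd heq.1 n2
      · exact heq
  omega

/-- `c` is a proper edge colouring of `G`. -/
def ProperEC {V : Type*} (G : SimpleGraph V) (c : Sym2 V → ℕ) : Prop :=
  ∀ a b b', G.Adj a b → G.Adj a b' → b ≠ b' → c s(a, b) ≠ c s(a, b')

/-- Colour `i` is missing at `u`. -/
def Miss {V : Type*} (G : SimpleGraph V) (c : Sym2 V → ℕ) (u : V) (i : ℕ) : Prop :=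
  ∀ b, G.Adj u b → c s(u, b) ≠ i

/-- The subgraph of edges with colour `i` or `j`. -/
def two {V : Type*} (G : SimpleGraph V) (c : Sym2 V → ℕ) (i j : ℕ) : SimpleGraph V where
  Adj a b := G.Adj a b ∧ (c s(a, b) = i ∨ c s(a, b) = j)
  symm := ⟨fun a b h => ⟨h.1.symm, by rw [Sym2.eq_swap]; exact h.2⟩⟩
  loopless := ⟨fun a h => G.loopless.irrefl a h.1⟩

open Classical in
theorem ends_le_two {W : Type*} [Fintype W] (K : SimpleGraph W) (hK : K.Connected)
    (S : Finset W) (h2 : ∀ v, K.degree v ≤ 2) (h1 : ∀ v ∈ S, K.degree v ≤ 1) : S.card ≤ 2 := by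
  have e1 := hK.card_vert_le_card_edgeSet_add_one
  have e2 := K.sum_degrees_eq_twice_card_edges
  have e3 : ∑ v : W, (K.degree v + if v ∈ S then 1 else 0) ≤ ∑ v : W, 2 := by
    refine Finset.sum_le_sum fun v _ => ?_
    by_cases h : v ∈ S
    · have := h1 v h
      simp only [h, if_true]; omega
    · have := h2 v
      simp only [h, if_false]; omega
  rw [Finset.sum_add_distrib, e2] at e3
  simp only [Finset.sum_boole, 
    Finset.sum_const, Finset.card_univ, smul_eq_mul, Nat.cast_id] at e3
  have e4 : (Finset.univ.filter (fun x => x ∈ S)) = S := by ext; simp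
  rw [Nat.card_eq_fintype_card, Nat.card_eq_fintype_card, ← edgeFinset_card] at e1
  simp only [e4] at e3
  omega

open Classical in
theorem comp_ends {V : Type*} [Fintype V] (G : SimpleGraph V) (c : Sym2 V → ℕ)
    (hc : ProperEC G c) (i j : ℕ) (C : (two G c i j).ConnectedComponent)
    (S : Finset V) (hS : ∀ u ∈ S, (two G c i j).connectedComponentMk u = C)
    (hm : ∀ u ∈ S, Miss G c u i) : S.card ≤ 2 := by
  have hinj : ∀ v : C.supp, Set.InjOn (fun w : C.supp => c s(v.1, w.1))
      (C.toSimpleGraph.neighborFinset v) := by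
    intro v w hw w' hw' h
    have hw : C.toSimpleGraph.Adj v w := by simpa using hw
    have hw' : C.toSimpleGraph.Adj v w' := by simpa using hw'
    by_contra hne
    exact hc v.1 w.1 w'.1 hw.1 hw'.1 (fun h => hne (Subtype.ext h)) h
  have := ends_le_two C.toSimpleGraph C.connected_toSimpleGraph (S.subtype (· ∈ C.supp)) ?_ ?_
  · rw [Finset.card_subtype, Finset.filter_true_of_mem] at this
    · exact this
    · exact fun u hu => hS u hu
  · intro v
    rw [← card_neighborFinset_eq_degree]
    refine (Finset.card_le_card_of_injOn (t := {i, j}) _ ?_ (hinj v)).trans Finset.card_le_two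
    intro w hw
    have hw : C.toSimpleGraph.Adj v w := by simpa using hw
    simpa using hw.2
  · intro v hv
    rw [← card_neighborFinset_eq_degree]
    refine (Finset.card_le_card_of_injOn (t := {j}) _ ?_ (hinj v)).trans (by simp)
    intro w hw
    have hw : C.toSimpleGraph.Adj v w := by simpa using hw
    have h2 := hm v.1 (by simpa using hv) w.1 hw.1
    simpa using hw.2.resolve_left h2

theorem sum_lt_of_two (K : Finset ℕ) (i j : ℕ) (hi : i ∈ K) (hj : j ∈ K) (hij : i ≠ j)
    (f g : ℕ → ℕ) (hfg : ∀ l, l ≠ i → l ≠ j → f l = g l) (h : f i + f j < g i + g j) :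
    ∑ l ∈ K, f l < ∑ l ∈ K, g l := by
  have hj' : j ∈ K.erase i := Finset.mem_erase.2 ⟨hij.symm, hj⟩
  rw [← Finset.add_sum_erase K f hi, ← Finset.add_sum_erase K g hi,
    ← Finset.add_sum_erase _ f hj', ← Finset.add_sum_erase _ g hj']
  have : ∑ x ∈ (K.erase i).erase j, f x = ∑ x ∈ (K.erase i).erase j, g x := by
    refine Finset.sum_congr rfl fun l hl => ?_
    simp only [Finset.mem_erase] at hl
    exact hfg l hl.2.1 hl.1
  omega

/-- `M` assigns to the vertices of `N` sets of missing colours from `K`. -/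
def Valid {V : Type*} (G : SimpleGraph V) (K : Finset ℕ) (N : Finset V) (c : Sym2 V → ℕ)
    (M : V → Finset ℕ) : Prop :=
  ∀ u ∈ N, M u ⊆ K ∧ ∀ i ∈ M u, Miss G c u i

/-- `c'` is obtained from `c` by recolouring within the colours `K`. -/
def Rel {V : Type*} (K : Finset ℕ) (c c' : Sym2 V → ℕ) : Prop :=
  ∀ e, (c e ∉ K → c' e = c e) ∧ (c e ∈ K → c' e ∈ K)

theorem swap_step {V : Type*} [Fintype V] (G : SimpleGraph V) (K : Finset ℕ) (N : Finset V)
    (c : Sym2 V → ℕ) (M : V → Finset ℕ) (hc : ProperEC G c) (hM : Valid G K N c M)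
    (i j : ℕ) (hi : i ∈ K) (hj : j ∈ K)
    (hlt : (N.filter (fun u => j ∈ M u)).card + 3 ≤ (N.filter (fun u => i ∈ M u)).card) :
    ∃ c' M', ProperEC G c' ∧ Valid G K N c' M' ∧ Rel K c c' ∧ (∀ u, (M' u).card = (M u).card) ∧
      ∑ l ∈ K, (N.filter (fun u => l ∈ M' u)).card ^ 2 <
        ∑ l ∈ K, (N.filter (fun u => l ∈ M u)).card ^ 2 := by
  classical
  have hij : i ≠ j := by rintro rfl; omega
  -- the component
  obtain ⟨C, hC⟩ : ∃ C : (two G c i j).ConnectedComponent,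
      ((N.filter (fun u => j ∈ M u)).filter
        (fun u => (two G c i j).connectedComponentMk u = C)).card <
      ((N.filter (fun u => i ∈ M u)).filter
        (fun u => (two G c i j).connectedComponentMk u = C)).card := by
    by_contra hcon
    push Not at hcon
    have h1 := Finset.card_eq_sum_card_fiberwise (f := (two G c i j).connectedComponentMk)
      (s := N.filter (fun u => i ∈ M u)) (t := Finset.univ) (by intro _ _; simp)
    have h2 := Finset.card_eq_sum_card_fiberwise (f := (two G c i j).connectedComponentMk)
      (s := N.filter (fun u => j ∈ M u)) (t := Finset.univ) (by intro _ _; simp)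
    have h3 := Finset.sum_le_sum (s := Finset.univ) fun C _ => hcon C
    rw [← h1, ← h2] at h3
    omega
  have hA2 := comp_ends G c hc i j C ((N.filter (fun u => i ∈ M u)).filter
        (fun u => (two G c i j).connectedComponentMk u = C))
        (fun u hu => (Finset.mem_filter.1 hu).2)
        (fun u hu => by
          have hu := (Finset.mem_filter.1 (Finset.mem_filter.1 hu).1)
          exact (hM u hu.1).2 i hu.2)
  let Z : V → Prop := fun u => (two G c i j).connectedComponentMk u = C
  have hZ : ∀ a b, G.Adj a b → (c s(a, b) = i ∨ c s(a, b) = j) → (Z a ↔ Z b) := by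
    intro a b hab h
    have : (two G c i j).connectedComponentMk a = (two G c i j).connectedComponentMk b :=
      ConnectedComponent.sound (SimpleGraph.Adj.reachable (show (two G c i j).Adj a b from ⟨hab, h⟩))
    simp only [Z, this]
  let σ := Equiv.swap i j
  let c' : Sym2 V → ℕ := fun e => if ∃ a ∈ e, Z a then σ (c e) else c e
  have hσ : ∀ l, l ≠ i → l ≠ j → σ l = l := fun l h1 h2 => Equiv.swap_apply_of_ne_of_ne h1 h2
  have hσK : ∀ l, l ∈ K → σ l ∈ K := by
    intro l hl
    by_cases h1 : l = i
    · rw [h1]; simpa [σ] using hj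
    · by_cases h2 : l = j
      · rw [h2]; simpa [σ] using hi
      · rwa [hσ l h1 h2]
  have hc' : ∀ a b, G.Adj a b → c' s(a, b) = if Z a then σ (c s(a, b)) else c s(a, b) := by
    intro a b hab
    by_cases hcol : c s(a, b) = i ∨ c s(a, b) = j
    · have := hZ a b hab hcol
      have h2 : (∃ z ∈ s(a, b), Z z) ↔ Z a := by
        simp only [Sym2.mem_iff, exists_eq_or_imp, exists_eq_left]
        tauto
      simp only [c', h2]
    · push Not at hcol
      have := hσ _ hcol.1 hcol.2
      simp only [c', this, ite_self]
  let M' : V → Finset ℕ := fun u => if Z u then (M u).image σ else M u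
  have hM'mem : ∀ u l, l ∈ M' u ↔ if Z u then σ l ∈ M u else l ∈ M u := by
    intro u l
    by_cases h : Z u
    · simp only [M', h, if_true, Finset.mem_image]
      constructor
      · rintro ⟨m, hm, rfl⟩
        simpa [σ] using hm
      · intro hl
        exact ⟨σ l, hl, by simp [σ]⟩
    · simp [M', h]
  refine ⟨c', M', ?_, ?_, ?_, ?_, ?_⟩
  · intro a b b' hab hab' hne
    rw [hc' a b hab, hc' a b' hab']
    have := hc a b b' hab hab' hne
    by_cases h : Z a
    · simpa [h] using this
    · simpa [h] using this
  · intro u hu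
    have h1 := hM u hu
    constructor
    · intro l hl
      rw [hM'mem] at hl
      by_cases h : Z u
      · simp only [h, if_true] at hl
        have := hσK _ (h1.1 hl)
        simpa [σ] using this
      · simp only [h, if_false] at hl
        exact h1.1 hl
    · intro l hl b hub
      rw [hM'mem] at hl
      rw [hc' u b hub]
      by_cases h : Z u
      · simp only [h, if_true] at hl ⊢
        intro heq
        apply h1.2 _ hl b hub
        rw [← heq]
        simp [σ]
      · simp only [h, if_false] at hl ⊢
        exact h1.2 _ hl b hub
  · intro e
    constructor
    · intro he
      have : σ (c e) = c e := hσ _ (fun h => he (h ▸ hi)) (fun h => he (h ▸ hj))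
      simp only [c', this, ite_self]
    · intro he
      simp only [c']
      split_ifs
      · exact hσK _ he
      · exact he
  · intro u
    by_cases h : Z u
    · simp only [M', h, if_true]
      exact Finset.card_image_of_injective _ σ.injective
    · simp [M', h]
  · have hσi : σ i = j := by simp [σ]
    have hσj : σ j = i := by simp [σ]
    have split : ∀ (P : V → Prop) [DecidablePred P], (N.filter P).card =
        ((N.filter P).filter Z).card + ((N.filter P).filter (fun u => ¬ Z u)).card :=
      fun P _ => (Finset.card_filter_add_card_filter_not (s := N.filter P) Z).symm
    have f1 : ((N.filter (fun u => i ∈ M' u)).filter Z) = ((N.filter (fun u => j ∈ M u)).filter Z) := by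
      ext u
      simp only [Finset.mem_filter, hM'mem, hσi]
      by_cases h : Z u <;> simp [h]
    have f2 : ((N.filter (fun u => j ∈ M' u)).filter Z) = ((N.filter (fun u => i ∈ M u)).filter Z) := by
      ext u
      simp only [Finset.mem_filter, hM'mem, hσj]
      by_cases h : Z u <;> simp [h]
    have f3 : ∀ l, ((N.filter (fun u => l ∈ M' u)).filter (fun u => ¬ Z u)) =
        ((N.filter (fun u => l ∈ M u)).filter (fun u => ¬ Z u)) := by
      intro l
      ext u
      simp only [Finset.mem_filter, hM'mem]
      by_cases h : Z u <;> simp [h]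
    refine sum_lt_of_two K i j hi hj hij _ _ ?_ ?_
    · intro l h1 h2
      have : (fun u => l ∈ M' u) = (fun u => l ∈ M u) := by
        funext u
        rw [hM'mem, hσ l h1 h2]
        simp
      simp only [this]
    · have s1 := split (fun u => i ∈ M' u)
      have s2 := split (fun u => j ∈ M' u)
      have s3 := split (fun u => i ∈ M u)
      have s4 := split (fun u => j ∈ M u)
      rw [f1, f3] at s1
      rw [f2, f3] at s2
      change ((N.filter (fun u => j ∈ M u)).filter Z).card <
        ((N.filter (fun u => i ∈ M u)).filter Z).card at hC
      change ((N.filter (fun u => i ∈ M u)).filter Z).card ≤ 2 at hA2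
      show _ ^ 2 + _ ^ 2 < _ ^ 2 + _ ^ 2
      generalize ((N.filter (fun u => j ∈ M u)).filter Z).card = B at *
      generalize ((N.filter (fun u => i ∈ M u)).filter Z).card = A at *
      generalize ((N.filter (fun u => j ∈ M u)).filter (fun u => ¬ Z u)).card = B' at *
      generalize ((N.filter (fun u => i ∈ M u)).filter (fun u => ¬ Z u)).card = A' at *
      rw [s1, s2, s3, s4]
      rw [s3, s4] at hlt
      obtain ⟨s, rfl⟩ := Nat.exists_eq_add_of_lt hC
      have hs : s ≤ 1 := by omega
      have hB : B ≤ 1 := by omega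
      interval_cases s <;> interval_cases B <;> nlinarith

theorem balance {V : Type*} [Fintype V] (G : SimpleGraph V) (K : Finset ℕ) (N : Finset V)
    (n : ℕ) (c : Sym2 V → ℕ) (M : V → Finset ℕ) (hc : ProperEC G c) (hM : Valid G K N c M)
    [DecidableEq V]
    (hn : ∑ l ∈ K, (N.filter (fun u => l ∈ M u)).card ^ 2 = n) :
    ∃ c' M', ProperEC G c' ∧ Valid G K N c' M' ∧ Rel K c c' ∧ (∀ u, (M' u).card = (M u).card) ∧
      ∀ i ∈ K, ∀ j ∈ K, (N.filter (fun u => i ∈ M' u)).card ≤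
        (N.filter (fun u => j ∈ M' u)).card + 2 := by
  induction n using Nat.strong_induction_on generalizing c M with
  | _ n ih =>
    by_cases h : ∀ i ∈ K, ∀ j ∈ K, (N.filter (fun u => i ∈ M u)).card ≤
        (N.filter (fun u => j ∈ M u)).card + 2
    · exact ⟨c, M, hc, hM, fun e => ⟨fun _ => rfl, id⟩, fun _ => rfl, h⟩
    · push Not at h
      obtain ⟨i, hi, j, hj, hlt⟩ := h
      obtain ⟨c1, M1, h1, h2, h3, h4, h5⟩ := swap_step G K N c M hc hM i j hi hj (by omega)
      obtain ⟨c2, M2, g1, g2, g3, g4, g5⟩ := ih _ (hn ▸ h5) c1 M1 h1 h2 rfl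
      refine ⟨c2, M2, g1, g2, ?_, fun u => (g4 u).trans (h4 u), g5⟩
      intro e
      refine ⟨fun h => ?_, fun h => (g3 e).2 ((h3 e).2 h)⟩
      have := (h3 e).1 h
      rw [(g3 e).1 (by rwa [this]), this]

theorem assign {V : Type*} [Fintype V] (G : SimpleGraph V) (n : ℕ) (K : Finset ℕ) (N : Finset V)
    (c : Sym2 V → ℕ) (M : V → Finset ℕ) (hc : ProperEC G c) (hM : Valid G K N c M)
    (hn : N.card = n) (hNK : N.card ≤ K.card) (h1 : ∀ u ∈ N, 1 ≤ (M u).card)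
    (us : V) (h2 : ∀ u ∈ N, u ≠ us → 2 ≤ (M u).card) :
    ∃ (c' : Sym2 V → ℕ) (a : V → ℕ), ProperEC G c' ∧ Rel K c c' ∧
      (∀ u ∈ N, a u ∈ K ∧ Miss G c' u (a u)) ∧ Set.InjOn a N := by
  classical
  induction n generalizing K N c M us with
  | zero =>
    have : N = ∅ := Finset.card_eq_zero.1 hn
    subst this
    exact ⟨c, fun _ => 0, hc, fun e => ⟨fun _ => rfl, id⟩, by simp, by simp⟩
  | succ n ih =>
    -- pick the exceptional vertex
    obtain ⟨u1, hu1N, hu1⟩ : ∃ u1 ∈ N, ∀ u ∈ N, u ≠ u1 → 2 ≤ (M u).card := by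
      by_cases h : us ∈ N
      · exact ⟨us, h, h2⟩
      · obtain ⟨u1, hu1⟩ : N.Nonempty := Finset.card_pos.1 (by omega)
        exact ⟨u1, hu1, fun u hu _ => h2 u hu (fun h' => h (h' ▸ hu))⟩
    have hex : ∀ u, ∃ T : Finset ℕ, u ∈ N → T ⊆ M u ∧ T.card = if u = u1 then 1 else 2 := by
      intro u
      by_cases hu : u ∈ N
      · have : (if u = u1 then 1 else 2) ≤ (M u).card := by
          split_ifs with h
          · exact h1 u hu
          · exact hu1 u hu h
        obtain ⟨T, hT, hTc⟩ := Finset.exists_subset_card_eq this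
        exact ⟨T, fun _ => ⟨hT, hTc⟩⟩
      · exact ⟨∅, fun h => absurd h hu⟩
    choose M0 hM0 using hex
    have hM0v : Valid G K N c M0 := fun u hu =>
      ⟨(hM0 u hu).1.trans (hM u hu).1, fun i hi => (hM u hu).2 i ((hM0 u hu).1 hi)⟩
    obtain ⟨c1, M1, hc1, hM1, hR1, hcard1, hbal⟩ := balance G K N _ c M0 hc hM0v rfl
    have hsum : ∑ l ∈ K, (N.filter (fun u => l ∈ M1 u)).card = 2 * n + 1 := by
      have e1 : ∑ l ∈ K, (N.filter (fun u => l ∈ M1 u)).card = ∑ u ∈ N, (M1 u).card := by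
        simp only [Finset.card_filter]
        rw [Finset.sum_comm]
        refine Finset.sum_congr rfl fun u hu => ?_
        rw [← Finset.card_filter, Finset.filter_mem_eq_inter, Finset.inter_eq_right.2 (hM1 u hu).1]
      rw [e1, ← Finset.add_sum_erase N _ hu1N, hcard1, (hM0 u1 hu1N).2]
      have e2 : ∑ u ∈ N.erase u1, (M1 u).card = ∑ u ∈ N.erase u1, 2 := by
        refine Finset.sum_congr rfl fun u hu => ?_
        rw [Finset.mem_erase] at hu
        rw [hcard1, (hM0 u hu.2).2, if_neg hu.1]
      rw [e2, Finset.sum_const, Finset.card_erase_of_mem hu1N, hn]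
      simp; omega
    obtain ⟨i, hi, hi1⟩ : ∃ i ∈ K, (N.filter (fun u => i ∈ M1 u)).card = 1 := by
      by_contra hcon
      push Not at hcon
      by_cases h0 : ∃ i ∈ K, (N.filter (fun u => i ∈ M1 u)).card = 0
      · obtain ⟨i, hi, hi0⟩ := h0
        have : 2 ∣ ∑ l ∈ K, (N.filter (fun u => l ∈ M1 u)).card := by
          refine Finset.dvd_sum fun l hl => ?_
          have a1 := hbal l hl i hi
          have a2 := hcon l hl
          omega
        omega
      · push Not at h0
        have : ∑ l ∈ K, 2 ≤ ∑ l ∈ K, (N.filter (fun u => l ∈ M1 u)).card := by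
          refine Finset.sum_le_sum fun l hl => ?_
          have a1 := h0 l hl
          have a2 := hcon l hl
          omega
        rw [Finset.sum_const, smul_eq_mul] at this
        omega
    obtain ⟨u0, hu0⟩ := Finset.card_eq_one.1 hi1
    have hu0' : u0 ∈ N ∧ i ∈ M1 u0 := by
      have : u0 ∈ N.filter (fun u => i ∈ M1 u) := by rw [hu0]; simp
      simpa using this
    obtain ⟨c2, a, hc2, hR2, ha, hainj⟩ := ih (K.erase i) (N.erase u0) c1 M1 hc1 (by
        intro u hu
        rw [Finset.mem_erase] at hu
        refine ⟨fun l hl => Finset.mem_erase.2 ⟨?_, (hM1 u hu.2).1 hl⟩, (hM1 u hu.2).2⟩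
        rintro rfl
        have : u ∈ N.filter (fun u => l ∈ M1 u) := Finset.mem_filter.2 ⟨hu.2, hl⟩
        rw [hu0] at this
        exact hu.1 (Finset.mem_singleton.1 this))
      (by rw [Finset.card_erase_of_mem hu0'.1]; omega)
      (by rw [Finset.card_erase_of_mem hu0'.1, Finset.card_erase_of_mem hi]; omega)
      (by
        intro u hu
        rw [Finset.mem_erase] at hu
        rw [hcard1, (hM0 u hu.2).2]
        split_ifs <;> omega) u1
      (by
        intro u hu hne
        rw [Finset.mem_erase] at hu
        rw [hcard1, (hM0 u hu.2).2, if_neg hne])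
    refine ⟨c2, Function.update a u0 i, hc2, ?_, ?_, ?_⟩
    · intro e
      constructor
      · intro h
        have e1 := (hR1 e).1 h
        rw [(hR2 e).1 (by rw [e1]; exact fun h' => h (Finset.mem_of_mem_erase h')), e1]
      · intro h
        have e1 := (hR1 e).2 h
        by_cases hie : c1 e = i
        · rw [(hR2 e).1 (by rw [hie]; simp)]
          exact e1
        · exact Finset.mem_of_mem_erase ((hR2 e).2 (Finset.mem_erase.2 ⟨hie, e1⟩))
    · intro u hu
      by_cases h : u = u0
      · subst h
        rw [Function.update_self]
        refine ⟨hi, fun b hb heq => ?_⟩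
        have e1 := (hM1 u hu).2 i hu0'.2 b hb
        by_cases hK : c1 s(u, b) ∈ K.erase i
        · have := (hR2 _).2 hK
          rw [heq] at this
          simp at this
        · rw [(hR2 _).1 hK] at heq
          exact e1 heq
      · rw [Function.update_of_ne h]
        have := ha u (Finset.mem_erase.2 ⟨h, hu⟩)
        exact ⟨Finset.mem_of_mem_erase this.1, this.2⟩
    · intro u hu w hw heq
      have hu : u ∈ N := hu
      have hw : w ∈ N := hw
      by_cases h : u = u0 <;> by_cases h' : w = u0
      · rw [h, h']
      · rw [h, Function.update_self, Function.update_of_ne h'] at heq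
        have := (ha w (Finset.mem_erase.2 ⟨h', hw⟩)).1
        rw [← heq] at this
        simp at this
      · rw [h', Function.update_self, Function.update_of_ne h] at heq
        have := (ha u (Finset.mem_erase.2 ⟨h, hu⟩)).1
        rw [heq] at this
        simp at this
      · rw [Function.update_of_ne h, Function.update_of_ne h'] at heq
        exact hainj (by simp [h, hu]) (by simp [h', hw]) heq

theorem mk_immersion {W : Type*} (L : SimpleGraph W) (t : ℕ) (φ : Fin t ↪ W)
    (C : Fin t → Fin t → Set (Sym2 W))
    (hC : ∀ i j, i < j → ∃ q : L.Walk (φ i) (φ j), ∀ e ∈ q.edges, e ∈ C i j)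
    (hdis : ∀ i j i' j', i < j → i' < j' → (i, j) ≠ (i', j') →
      ∀ e, ¬ e.IsDiag → e ∈ C i j → e ∈ C i' j' → False) :
    CliqueImmersion L t := by
  classical
  have hC' : ∀ i j, ∃ q : L.Walk (φ i) (φ j), i < j → q.IsPath ∧ ∀ e ∈ q.edges, e ∈ C i j := by
    intro i j
    rcases lt_trichotomy i j with h | h | h
    · obtain ⟨q, hq⟩ := hC i j h
      exact ⟨q.bypass, fun _ => ⟨q.bypass_isPath, fun e he =>
        hq e (q.edges_bypass_subset_edges he)⟩⟩
    · subst h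
      exact ⟨Walk.nil, fun h => absurd h (lt_irrefl _)⟩
    · obtain ⟨q, hq⟩ := hC j i h
      exact ⟨q.reverse, fun h' => absurd h' (lt_asymm h)⟩
  choose P hP using hC'
  refine ⟨φ, P, fun i j h => (hP i j h).1, ?_⟩
  intro i j i' j' h h' hne e he he'
  exact hdis i j i' j' h h' hne e (L.not_isDiag_of_mem_edgeSet ((P i j).edges_subset_edgeSet he))
    ((hP i j h).2 e he) ((hP i' j' h').2 e he')

theorem line_step {V : Type*} (H : SimpleGraph V) (e e' : H.edgeSet) (w : V)
    (h : w ∈ e.1) (h' : w ∈ e'.1) :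
    ∃ q : H.lineGraph.Walk e e', ∀ z ∈ q.support, z = e ∨ z = e' := by
  by_cases hee : e = e'
  · subst hee
    exact ⟨Walk.nil, by simp⟩
  · have : H.lineGraph.Adj e e' := by
      refine ⟨hee, ⟨w, ?_⟩⟩
      exact ⟨h, h'⟩
    exact ⟨Walk.cons this Walk.nil, by simp⟩

theorem line_walk {V : Type*} (H : SimpleGraph V) {u y : V} (p : H.Walk u y)
    (g : H.edgeSet) (hg : y ∈ g.1) (w : V) (hw : w ∈ p.support) (e : H.edgeSet) (he : w ∈ e.1) :
    ∃ q : H.lineGraph.Walk e g, ∀ z ∈ q.support, z = e ∨ z = g ∨ z.1 ∈ p.edges := by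
  induction p generalizing w e with
  | nil =>
    simp only [Walk.support_nil, List.mem_singleton] at hw
    subst hw
    obtain ⟨q, hq⟩ := line_step H e g w he hg
    exact ⟨q, fun z hz => by rcases hq z hz with h | h <;> simp [h]⟩
  | @cons a b c h p ih =>
    rw [Walk.support_cons, List.mem_cons] at hw
    rcases hw with rfl | hw
    · obtain ⟨q1, hq1⟩ := line_step H e ⟨s(w, b), h⟩ w he (by simp)
      obtain ⟨q2, hq2⟩ := ih hg b (Walk.start_mem_support p) ⟨s(w, b), h⟩ (by simp)
      refine ⟨q1.append q2, fun z hz => ?_⟩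
      rw [Walk.mem_support_append_iff] at hz
      rcases hz with hz | hz
      · rcases hq1 z hz with h | h
        · exact Or.inl h
        · right; right; rw [h]; simp
      · rcases hq2 z hz with h | h | h
        · right; right; rw [h]; simp
        · exact Or.inr (Or.inl h)
        · right; right; simp [h]
    · obtain ⟨q, hq⟩ := ih hg w hw e he
      refine ⟨q, fun z hz => ?_⟩
      rcases hq z hz with h | h | h
      · exact Or.inl h
      · exact Or.inr (Or.inl h)
      · right; right; simp [h]

theorem exists_first {V : Type*} (H : SimpleGraph V) {x y : V} (hxy : x ≠ y) (p : H.Walk x y) :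
    ∃ e : H.edgeSet, e.1 ∈ p.edges ∧ x ∈ e.1 := by
  cases p with
  | nil => exact absurd rfl hxy
  | @cons _ b _ h p => exact ⟨⟨s(x, b), h⟩, by simp, by simp⟩

theorem immersion_of_paths {V : Type*} (H : SimpleGraph V) {x y : V} (hxy : x ≠ y) (k : ℕ)
    (hk : 2 ≤ k) (p : Fin k → H.Walk x y)
    (hp : ∀ i j, i ≠ j → List.Disjoint (p i).edges (p j).edges) :
    CliqueImmersion H.lineGraph (k + 1) := by
  choose a ha hxa using fun i => exists_first H hxy (p i)
  have hg : ∃ g : H.edgeSet, y ∈ g.1 ∧ x ∉ g.1 := by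
    obtain ⟨b, hb, hyb⟩ := exists_first H hxy.symm (p ⟨0, by omega⟩).reverse
    obtain ⟨b', hb', hyb'⟩ := exists_first H hxy.symm (p ⟨1, by omega⟩).reverse
    by_contra hcon
    push Not at hcon
    have h1 : b.1 = s(x, y) := (Sym2.mem_and_mem_iff hxy).1 ⟨hcon b hyb, hyb⟩
    have h2 : b'.1 = s(x, y) := (Sym2.mem_and_mem_iff hxy).1 ⟨hcon b' hyb', hyb'⟩
    rw [Walk.edges_reverse, List.mem_reverse, h1] at hb
    rw [Walk.edges_reverse, List.mem_reverse, h2] at hb'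
    exact hp ⟨0, by omega⟩ ⟨1, by omega⟩ (by simp) hb hb'
  obtain ⟨g, hyg, hxg⟩ := hg
  have hag : ∀ i, a i ≠ g := fun i h => hxg (h ▸ hxa i)
  have hmem : ∀ i j, (a i).1 ∈ (p j).edges → i = j := by
    intro i j h
    by_contra hne
    exact hp i j hne (ha i) h
  have hainj : Function.Injective a := by
    intro i j h
    exact hmem i j (h ▸ ha j)
  let φ : Fin (k + 1) → H.edgeSet := Fin.snoc (α := fun _ => H.edgeSet) a g
  have hφc : ∀ i : Fin k, φ i.castSucc = a i := fun i => Fin.snoc_castSucc (α := fun _ => H.edgeSet) ..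
  have hφl : φ (Fin.last k) = g := Fin.snoc_last (α := fun _ => H.edgeSet) ..
  have hφ : Function.Injective φ := by
    intro i j
    refine Fin.lastCases ?_ (fun i => ?_) i <;> refine Fin.lastCases ?_ (fun j => ?_) j
    · intro _; rfl
    · rw [hφc, hφl]; intro h; exact absurd h.symm (hag j)
    · rw [hφc, hφl]; intro h; exact absurd h (hag i)
    · rw [hφc, hφc]; intro h; rw [hainj h]
  refine mk_immersion H.lineGraph (k + 1) ⟨φ, hφ⟩
    (fun i j => {e | (j = Fin.last k → ∃ m : Fin k, i = m.castSucc ∧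
        ∀ z ∈ e, z = g ∨ z.1 ∈ (p m).edges) ∧
      (j ≠ Fin.last k → e = s(φ i, φ j))}) ?_ ?_
  · intro i j hij
    by_cases hj : j = Fin.last k
    · subst hj
      obtain ⟨m, rfl⟩ : ∃ m : Fin k, i = m.castSucc := ⟨i.castLT hij, by simp⟩
      obtain ⟨q, hq⟩ := line_walk H (p m) g hyg x (Walk.start_mem_support _) (a m) (hxa m)
      refine ⟨q.copy (hφc m).symm hφl.symm, ?_⟩
      intro e he
      rw [Walk.edges_copy] at he
      refine ⟨fun _ => ⟨m, rfl, fun z hz => ?_⟩, fun h => absurd rfl h⟩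
      have hz' : z ∈ q.support := Walk.mem_support_of_mem_edges he hz
      rcases hq z hz' with h | h | h
      · right; rw [h]; exact ha m
      · exact Or.inl h
      · exact Or.inr h
    · have hi : i ≠ Fin.last k := fun h => by
        subst h; exact absurd hij (not_lt.2 (Fin.le_last j))
      obtain ⟨m, rfl⟩ := Fin.exists_castSucc_eq.2 hi
      obtain ⟨n, rfl⟩ := Fin.exists_castSucc_eq.2 hj
      have hadj : H.lineGraph.Adj (φ m.castSucc) (φ n.castSucc) := by
        rw [hφc, hφc]
        refine ⟨fun h => ?_, ⟨x, hxa m, hxa n⟩⟩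
        have := hainj h
        subst this
        exact lt_irrefl _ hij
      refine ⟨Walk.cons hadj Walk.nil, ?_⟩
      intro e he
      refine ⟨fun h => absurd h hj, fun _ => ?_⟩
      simpa using he
  · intro i j i' j' hij hij' hne e hd h1 h2
    have aux : ∀ i j i' : Fin (k+1), i < j → j ≠ Fin.last k → e = s(φ i, φ j) →
        (∃ m : Fin k, i' = m.castSucc ∧ ∀ z ∈ e, z = g ∨ z.1 ∈ (p m).edges) → False := by
      intro i j i' hij hj he hm
      have hi : i ≠ Fin.last k := fun h => by
        subst h; exact absurd hij (not_lt.2 (Fin.le_last j))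
      obtain ⟨m, rfl⟩ := Fin.exists_castSucc_eq.2 hi
      obtain ⟨n, rfl⟩ := Fin.exists_castSucc_eq.2 hj
      obtain ⟨l, _, hl⟩ := hm
      rw [hφc, hφc] at he
      have e1 := hmem m l ((hl (a m) (by rw [he]; simp)).resolve_left (hag m))
      have e2 := hmem n l ((hl (a n) (by rw [he]; simp)).resolve_left (hag n))
      rw [e1, e2] at hij
      exact lt_irrefl _ hij
    by_cases hj : j = Fin.last k <;> by_cases hj' : j' = Fin.last k
    · obtain ⟨m, hm, hmz⟩ := h1.1 hj
      obtain ⟨n, hn, hnz⟩ := h2.1 hj'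
      have hmn : m ≠ n := by
        rintro rfl
        apply hne
        rw [hm, hn, hj, hj']
      have : ∀ z ∈ e, z = g := by
        intro z hz
        rcases hmz z hz with h | h
        · exact h
        · rcases hnz z hz with h' | h'
          · exact h'
          · exact absurd h' (fun h' => hp m n hmn h h')
      induction e using Sym2.ind with
      | _ c d =>
        apply hd
        rw [Sym2.mk_isDiag_iff, this c (by simp), this d (by simp)]
    · exact aux i' j' i hij' hj' (h2.2 hj') (h1.1 hj)
    · exact aux i j i' hij hj (h1.2 hj) (h2.1 hj')
    · have := (h1.2 hj).symm.trans (h2.2 hj')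
      rw [Sym2.eq_iff] at this
      rcases this with ⟨h, h'⟩ | ⟨h, h'⟩
      · exact hne (Prod.ext (hφ h) (hφ h'))
      · have e1 := hφ h
        have e2 := hφ h'
        subst e1 e2
        exact lt_asymm hij hij'

theorem immersion_of_star {V : Type*} (H : SimpleGraph V) (x : V) (t : ℕ)
    (N : Finset V) (hN : t ≤ N.card) (hadj : ∀ w ∈ N, H.Adj x w) :
    CliqueImmersion H.lineGraph t := by
  obtain ⟨f⟩ : Nonempty (Fin t ↪ N) :=
    Function.Embedding.nonempty_of_card_le (by simpa using hN)
  let φ : Fin t → H.edgeSet := fun i => ⟨s(x, (f i).1), hadj _ (f i).2⟩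
  have hφ : Function.Injective φ := by
    intro i j h
    have h1 : s(x, (f i).1) = s(x, (f j).1) := congrArg Subtype.val h
    exact f.injective (Subtype.ext (Sym2.congr_right.1 h1))
  refine mk_immersion H.lineGraph t ⟨φ, hφ⟩ (fun i j => {s(φ i, φ j)}) ?_ ?_
  · intro i j hij
    have h : H.lineGraph.Adj (φ i) (φ j) :=
      ⟨fun h => hij.ne (hφ h), ⟨x, by simp [φ], by simp [φ]⟩⟩
    exact ⟨Walk.cons h Walk.nil, by intro e he; simpa using he⟩
  · intro i j i' j' hij hij' hne e _ h1 h2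
    have := (Set.mem_singleton_iff.1 h1).symm.trans (Set.mem_singleton_iff.1 h2)
    rw [Sym2.eq_iff] at this
    rcases this with ⟨h, h'⟩ | ⟨h, h'⟩
    · exact hne (Prod.ext (hφ h) (hφ h'))
    · have e1 := hφ h
      have e2 := hφ h'
      subst e1 e2
      exact lt_asymm hij hij'

/-- `G` has a proper edge colouring with `k` colours. -/
def EC {V : Type*} (G : SimpleGraph V) (k : ℕ) : Prop :=
  ∃ c : Sym2 V → ℕ, ProperEC G c ∧ ∀ a b, G.Adj a b → c s(a, b) < k

theorem EC.colorable {V : Type*} (G : SimpleGraph V) (k : ℕ) (h : EC G k) :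
    G.lineGraph.Colorable k := by
  obtain ⟨c, hc, hk⟩ := h
  have hk' : ∀ e : G.edgeSet, c e.1 < k := by
    rintro ⟨e, he⟩
    induction e using Sym2.ind with
    | _ a b => exact hk a b he
  refine ⟨Coloring.mk (fun e => (⟨c e.1, hk' e⟩ : Fin k)) ?_⟩
  rintro ⟨e, he⟩ ⟨e', he'⟩ ⟨hne, w, hw, hw'⟩ heq
  have heq : c e = c e' := congrArg Fin.val heq
  have hw : w ∈ e := hw
  have hw' : w ∈ e' := hw'
  obtain ⟨b, rfl⟩ := hw
  obtain ⟨b', rfl⟩ := hw'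
  refine hc w b b' he he' ?_ heq
  rintro rfl
  exact hne rfl

open Classical in
/-- Vizing adjacency: in a critical graph every non-isolated vertex has two neighbours
of degree at least `k`. -/
theorem vizing_adj {V : Type*} [Fintype V] (G : SimpleGraph V) (k : ℕ)
    (hdeg : ∀ v, G.degree v ≤ k) (hG : ¬ EC G k) (hcrit : ∀ G' < G, EC G' k)
    (w x : V) (hwx : G.Adj w x) : ∃ u, G.degree u = k ∧ G.Adj w u ∧ u ≠ x := by
  by_contra hcon
  push Not at hcon
  apply hG
  let G0 : SimpleGraph V :=
    { Adj := fun a b => G.Adj a b ∧ a ≠ w ∧ b ≠ w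
      symm := ⟨fun a b h => ⟨h.1.symm, h.2.2, h.2.1⟩⟩
      loopless := ⟨fun a h => G.loopless.irrefl a h.1⟩ }
  have hlt : G0 < G := by
    refine lt_of_le_of_ne (fun a b h => h.1) ?_
    intro h
    have : G0.Adj w x := h ▸ hwx
    exact this.2.1 rfl
  obtain ⟨c, hc, hck⟩ := hcrit G0 hlt
  let M : V → Finset ℕ := fun u => (Finset.range k).filter (fun i => Miss G0 c u i)
  have hMcard : ∀ u, G.Adj w u → k + 1 ≤ (M u).card + G.degree u := by
    intro u hu
    have h1 : Finset.range k ⊆ M u ∪ ((G.neighborFinset u).erase w).image (fun b => c s(u, b)) := by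
      intro i hi
      by_cases h : Miss G0 c u i
      · exact Finset.mem_union_left _ (Finset.mem_filter.2 ⟨hi, h⟩)
      · apply Finset.mem_union_right
        unfold Miss at h
        push Not at h
        obtain ⟨b, hb, hbi⟩ := h
        refine Finset.mem_image.2 ⟨b, ?_, hbi⟩
        rw [Finset.mem_erase, mem_neighborFinset]
        exact ⟨hb.2.2, hb.1⟩
    have h2 := Finset.card_le_card h1
    have h3 := Finset.card_union_le (M u) (((G.neighborFinset u).erase w).image (fun b => c s(u, b)))
    have h4 := Finset.card_image_le (s := (G.neighborFinset u).erase w) (f := fun b => c s(u, b))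
    rw [Finset.card_erase_of_mem (by simpa using hu.symm), card_neighborFinset_eq_degree] at h4
    have h5 : 0 < G.degree u := (G.degree_pos_iff_exists_adj u).2 ⟨w, hu.symm⟩
    rw [Finset.card_range] at h2
    omega
  obtain ⟨c', a, hc', hR, ha, hainj⟩ := assign G0 _ (Finset.range k) (G.neighborFinset w) c M hc
    (fun u _ => ⟨Finset.filter_subset _ _, fun i hi => (Finset.mem_filter.1 hi).2⟩) rfl
    (by rw [card_neighborFinset_eq_degree, Finset.card_range]; exact hdeg w)
    (fun u hu => by
      have := hMcard u (by simpa using hu)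
      have := hdeg u
      omega) x
    (fun u hu hne => by
      have hu : G.Adj w u := by simpa using hu
      have := hMcard u hu
      have := hdeg u
      have : G.degree u ≠ k := fun h => hne (hcon u h hu)
      omega)
  have ha' : ∀ u, G.Adj w u → a u < k ∧ Miss G0 c' u (a u) := fun u hu => by
    have := ha u (by simpa using hu)
    rwa [Finset.mem_range] at this
  let d : Sym2 V → ℕ := fun e => if h : w ∈ e then a (Sym2.Mem.other h) else c' e
  have hd1 : ∀ u, d s(w, u) = a u := by
    intro u
    have h : w ∈ s(w, u) := by simp
    have h2 : Sym2.Mem.other h = u := Sym2.congr_right.1 (Sym2.other_spec h)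
    simp only [d, h, dif_pos, h2]
  have hd2 : ∀ u b, u ≠ w → b ≠ w → d s(u, b) = c' s(u, b) := by
    intro u b hu hb
    have h : w ∉ s(u, b) := by simp [hu.symm, hb.symm]
    simp only [d, h, dif_neg, not_false_eq_true]
  refine ⟨d, ?_, ?_⟩
  · intro u b b' hb hb' hne
    by_cases hu : u = w
    · subst hu
      rw [hd1, hd1]
      exact fun h => hne (hainj (by simpa using hb) (by simpa using hb') h)
    · by_cases h : b = w <;> by_cases h' : b' = w
      · exact absurd (h.trans h'.symm) hne
      · subst h
        rw [Sym2.eq_swap, hd1, hd2 u b' hu h']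
        exact ((ha' u hb.symm).2 b' ⟨hb', hu, h'⟩).symm
      · subst h'
        rw [hd2 u b hu h, Sym2.eq_swap (a := u) (b := b'), hd1]
        exact (ha' u hb'.symm).2 b ⟨hb, hu, h⟩
      · rw [hd2 u b hu h, hd2 u b' hu h']
        exact hc' u b b' ⟨hb, hu, h⟩ ⟨hb', hu, h'⟩ hne
  · intro u b hub
    by_cases hu : u = w
    · subst hu
      rw [hd1]
      exact (ha' b hub).1
    · by_cases h : b = w
      · subst h
        rw [Sym2.eq_swap, hd1]
        exact (ha' u hub.symm).1
      · rw [hd2 u b hu h]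
        have h1 := hck u b ⟨hub, hu, h⟩
        exact Finset.mem_range.1 ((hR _).2 (Finset.mem_range.2 h1))

theorem exists_critical {V : Type*} [Fintype V] (H : SimpleGraph V) (k : ℕ) (hH : ¬ EC H k) :
    ∃ G ≤ H, ¬ EC G k ∧ ∀ G' < G, EC G' k := by
  classical
  obtain ⟨G, hG, hmin⟩ := exists_minimal_le_of_wellFoundedLT (fun G : SimpleGraph V => ¬ EC G k) H hH
  refine ⟨G, hG, hmin.prop, fun G' hlt => ?_⟩
  by_contra h
  exact hmin.not_prop_of_lt hlt h
end LGI

/-- The Abu-Khzam–Langston conjecture holds for line graphs of simple graphs: the line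
graph of a simple graph contains an immersion of the complete graph on `χ(G)` vertices. -/
theorem statement19 {V : Type*} [Fintype V] (H : SimpleGraph V) (t : ℕ)
    (ht : (H.lineGraph).chromaticNumber = (t : ℕ∞)) :
    CliqueImmersion H.lineGraph t := by
  classical
  by_cases hstar : ∃ x, t ≤ H.degree x
  · obtain ⟨x, hx⟩ := hstar
    exact LGI.immersion_of_star H x t (H.neighborFinset x) (by simpa using hx) (by simp)
  push Not at hstar
  cases t with
  | zero => exact ⟨⟨fun i => i.elim0, fun i => i.elim0⟩, fun i => i.elim0, fun i => i.elim0,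
      fun i => i.elim0⟩
  | succ k =>
    have hEC : ¬ LGI.EC H k := by
      intro h
      have h1 := (h.colorable).chromaticNumber_le
      rw [ht] at h1
      have h2 : k + 1 ≤ k := by exact_mod_cast h1
      omega
    obtain ⟨G, hGH, hG, hcrit⟩ := LGI.exists_critical H k hEC
    have hdeg : ∀ v, G.degree v ≤ k := fun v =>
      (SimpleGraph.degree_le_of_le hGH).trans (Nat.lt_succ_iff.1 (hstar v))
    have hV := LGI.vizing_adj G k hdeg hG hcrit
    obtain ⟨w, x, hwx⟩ : ∃ w x, G.Adj w x := by
      by_contra hcon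
      push Not at hcon
      exact hG ⟨fun _ => 0, fun a b _ hab => absurd hab (hcon a b), fun a b hab =>
        absurd hab (hcon a b)⟩
    obtain ⟨u, hu, hwu, hux⟩ := hV w x hwx
    have hk : 2 ≤ k := by
      refine le_trans ?_ (hdeg w)
      rw [← SimpleGraph.card_neighborFinset_eq_degree]
      exact Finset.one_lt_card.2 ⟨u, by simpa using hwu, x, by simpa using hwx, hux⟩
    obtain ⟨a, -, b, -, hab, hcut⟩ := LGI.exists_pair G k
      (Finset.univ.filter (fun v => G.degree v = k))
      (fun v hv => ⟨G.neighborFinset v, by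
        rw [SimpleGraph.card_neighborFinset_eq_degree]
        exact (Finset.mem_filter.1 hv).2.ge, by simp⟩)
      (fun w x h => by
        obtain ⟨u, h1, h2, h3⟩ := hV w x h
        exact ⟨u, by simpa using h1, h2, h3⟩)
      ⟨u, by simpa using hu⟩ (by omega)
    obtain ⟨p, hp⟩ := LGI.menger G hab k hcut
    refine LGI.immersion_of_paths H hab k hk (fun i => (p i).mapLe hGH) ?_
    intro i j hij
    simpa using hp i j hij
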